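/- arXiv:1707.05418 — 3 statements merged into one kernel-verified Lean document; each statement's English description precedes it below -/
import Mathlib

section
/- (Core construction in the proof of Proposition 2.) Let Φzd : ℕ → Matrix (Fin p) (Fin m) ℝ and Φψd : ℕ → Matrix (Fin q) (Fin m) ℝ be kernels, θ ≥ 0, α ≥ 0, t_a ∈ ℕ. Suppose d is feasible, i.e. |d(k)| ≤ α for all k ≤ t_a, d(k) = 0 for all k > t_a, and |(Φψd * d)(τ)| ≤ θ for all τ ≤ t_a. Then for any n ≤ t_a at which the convolution output z = Φzd * d is evaluated, there exists a feasible signal d′ (namely d delayed by t_a − n after truncating its support appropriately, which applies whenever d(k) = 0 for k > n) such that |(Φzd * d′)(t_a)| = |(Φzd * d)(n)|. -/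
/-- Causal convolution of a kernel `Φ` with a signal `d`:
`(Φ * d)(n) = ∑_{k=0}^{n} Φ(n−k) · d(k)`. -/
noncomputable def conv {p m : ℕ} (Φ : ℕ → Matrix (Fin p) (Fin m) ℝ)
    (d : ℕ → Fin m → ℝ) (n : ℕ) : Fin p → ℝ :=
  ∑ k ∈ Finset.range (n + 1), (Φ (n - k)).mulVec (d k)

/-- A signal `d` is feasible (Scenario 2, stealthiness enforced up to `t_a`) if
`|d(k)| ≤ α` for all `k ≤ t_a`, `d(k) = 0` for `k > t_a`, and
`|(Φψd * d)(τ)| ≤ θ` for all `τ ≤ t_a`. -/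
def Feasible {q m : ℕ} (Φψd : ℕ → Matrix (Fin q) (Fin m) ℝ) (θ α : ℝ)
    (t_a : ℕ) (d : ℕ → Fin m → ℝ) : Prop :=
  (∀ k, k ≤ t_a → ‖d k‖ ≤ α) ∧ (∀ k, t_a < k → d k = 0) ∧
  (∀ τ, τ ≤ t_a → ‖conv Φψd d τ‖ ≤ θ)

/-- The signal `d` delayed by `s` time steps, padded with zeros. -/
def delay {m : ℕ} (s : ℕ) (d : ℕ → Fin m → ℝ) (k : ℕ) : Fin m → ℝ :=
  if k < s then 0 else d (k - s)

theorem delay_of_lt {m s k : ℕ} (d : ℕ → Fin m → ℝ) (h : k < s) : delay s d k = 0 :=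
  if_pos h

theorem delay_add {m : ℕ} (s k : ℕ) (d : ℕ → Fin m → ℝ) : delay s d (s + k) = d k := by
  simp [delay]

theorem conv_delay_of_lt {p m s t : ℕ} (Φ : ℕ → Matrix (Fin p) (Fin m) ℝ)
    (d : ℕ → Fin m → ℝ) (h : t < s) : conv Φ (delay s d) t = 0 := by
  refine Finset.sum_eq_zero fun k hk => ?_
  rw [Finset.mem_range] at hk
  rw [delay_of_lt d (by omega), Matrix.mulVec_zero]

/-- Causal convolution commutes with delays. -/
theorem conv_delay_add {p m : ℕ} (Φ : ℕ → Matrix (Fin p) (Fin m) ℝ)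
    (d : ℕ → Fin m → ℝ) (s t : ℕ) : conv Φ (delay s d) (s + t) = conv Φ d t := by
  unfold conv
  rw [add_assoc, Finset.sum_range_add, Finset.sum_eq_zero, zero_add]
  · refine Finset.sum_congr rfl fun k _ => ?_
    rw [delay_add, Nat.add_sub_add_left]
  · intro k hk
    rw [delay_of_lt d (Finset.mem_range.1 hk), Matrix.mulVec_zero]

/-- Core construction in the proof of Proposition 2: a feasible attack supported on
`{0,…,n}` with `n ≤ t_a` can be delayed by `t_a − n` into a feasible attack whose
impact at time `t_a` equals the original impact at time `n`. -/
theorem shift_attack_to_last_row {p q m : ℕ}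
    (Φzd : ℕ → Matrix (Fin p) (Fin m) ℝ)
    (Φψd : ℕ → Matrix (Fin q) (Fin m) ℝ)
    (θ α : ℝ) (hθ : 0 ≤ θ) (hα : 0 ≤ α) (t_a : ℕ)
    (d : ℕ → Fin m → ℝ)
    (hfeas : Feasible Φψd θ α t_a d)
    (n : ℕ) (hn : n ≤ t_a)
    (hsupp : ∀ k, n < k → d k = 0) :
    ∃ d' : ℕ → Fin m → ℝ,
      Feasible Φψd θ α t_a d' ∧
      ‖conv Φzd d' t_a‖ = ‖conv Φzd d n‖ := by
  obtain ⟨hbound, -, hstealth⟩ := hfeas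
  obtain ⟨s, rfl⟩ := Nat.exists_eq_add_of_le' hn
  refine ⟨delay s d, ⟨fun k hk => ?_, fun k hk => ?_, fun τ hτ => ?_⟩, ?_⟩
  · rcases lt_or_ge k s with h | h
    · simpa [delay_of_lt d h] using hα
    · obtain ⟨j, rfl⟩ := Nat.exists_eq_add_of_le h
      rw [delay_add]
      exact hbound j (by omega)
  · obtain ⟨j, rfl⟩ := Nat.exists_eq_add_of_le (show s ≤ k by omega)
    rw [delay_add]
    exact hsupp j (by omega)
  · rcases lt_or_ge τ s with h | h
    · simpa [conv_delay_of_lt Φψd d h] using hθ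
    · obtain ⟨j, rfl⟩ := Nat.exists_eq_add_of_le h
      rw [conv_delay_add]
      exact hstealth j (by omega)
  · rw [conv_delay_add]
end

section
/- (Tail impact bound, Remark 1 of Section III.) Let Φzd : ℕ → Matrix (Fin p) (Fin m) ℝ be a kernel, α ≥ 0, t_a, t_zd ∈ ℕ, and suppose d is a signal with |d(k)| ≤ α for all k and d(k) = 0 for all k > t_a. Then for every n > t_a + t_zd, |(Φzd * d)(n)| ≤ α · max_{i ∈ Fin p} ∑_{k > t_zd} ∑_{j ∈ Fin m} |Φzd(k)ᵢⱼ|. Consequently, if this tail bound is at most max_{0 ≤ n ≤ t_a + t_zd} |(Φzd * d)(n)|, then sup_{n ∈ ℕ} |(Φzd * d)(n)| = max_{0 ≤ n ≤ t_a + t_zd} |(Φzd * d)(n)|; i.e., a sufficiently long window t_zd captures the worst-case ℓ∞ impact. -/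
theorem abs_mulVec_apply_le {p m : ℕ} (A : Matrix (Fin p) (Fin m) ℝ) {v : Fin m → ℝ} {α : ℝ}
    (hv : ‖v‖ ≤ α) (i : Fin p) : |A.mulVec v i| ≤ α * ∑ j, |A i j| := by
  rw [Matrix.mulVec, dotProduct, Finset.mul_sum]
  refine (Finset.abs_sum_le_sum_abs _ _).trans (Finset.sum_le_sum fun j _ => ?_)
  rw [abs_mul, mul_comm]
  exact mul_le_mul_of_nonneg_right ((norm_le_pi_norm v j).trans hv) (abs_nonneg _)

theorem conv_eq_sum_range_of_support {p m : ℕ} (Φ : ℕ → Matrix (Fin p) (Fin m) ℝ)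
    {d : ℕ → Fin m → ℝ} {t n : ℕ} (hd : ∀ k, t < k → d k = 0) (hn : t ≤ n) :
    conv Φ d n = ∑ k ∈ Finset.range (t + 1), (Φ (n - k)).mulVec (d k) := by
  refine (Finset.sum_subset (Finset.range_mono (by omega)) fun k _ hk => ?_).symm
  rw [hd k (by simpa using hk), Matrix.mulVec_zero]

theorem sum_range_sub_le_tsum {f : ℕ → ℝ} (hf : ∀ k, 0 ≤ f k) {s t n : ℕ} (hn : t + s < n)
    (hsum : Summable fun k => f (k + s + 1)) :
    ∑ k ∈ Finset.range (t + 1), f (n - k) ≤ ∑' k, f (k + s + 1) := by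
  have hinj : Set.InjOn (fun k => n - k - s - 1) (Finset.range (t + 1) : Set ℕ) := by
    intro a ha b hb hab
    simp only [Finset.coe_range, Set.mem_Iio] at ha hb hab
    omega
  have heq : ∑ k ∈ Finset.range (t + 1), f (n - k) =
      ∑ k ∈ (Finset.range (t + 1)).image (fun k => n - k - s - 1), f (k + s + 1) := by
    rw [Finset.sum_image hinj]
    refine Finset.sum_congr rfl fun k hk => congrArg f ?_
    rw [Finset.mem_range] at hk
    omega
  rw [heq]
  exact hsum.sum_le_tsum _ fun k _ => hf _

theorem norm_conv_le_tail {p m : ℕ} (Φ : ℕ → Matrix (Fin p) (Fin m) ℝ) {α : ℝ} (hα : 0 ≤ α)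
    {t s n : ℕ} (hsum : ∀ i : Fin p, Summable fun k : ℕ => ∑ j, |Φ (k + s + 1) i j|)
    {d : ℕ → Fin m → ℝ} (hmag : ∀ k, ‖d k‖ ≤ α) (hsupp : ∀ k, t < k → d k = 0)
    (hn : t + s < n) :
    ‖conv Φ d n‖ ≤ α * ⨆ i : Fin p, ∑' k : ℕ, ∑ j, |Φ (k + s + 1) i j| := by
  have hnonneg : 0 ≤ ⨆ i : Fin p, ∑' k : ℕ, ∑ j, |Φ (k + s + 1) i j| :=
    Real.iSup_nonneg fun i => tsum_nonneg fun k => Finset.sum_nonneg fun j _ => abs_nonneg _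
  refine (pi_norm_le_iff_of_nonneg (mul_nonneg hα hnonneg)).2 fun i => ?_
  rw [conv_eq_sum_range_of_support Φ hsupp (by omega), Finset.sum_apply, Real.norm_eq_abs]
  calc |∑ k ∈ Finset.range (t + 1), (Φ (n - k)).mulVec (d k) i|
      ≤ ∑ k ∈ Finset.range (t + 1), α * ∑ j, |Φ (n - k) i j| :=
        (Finset.abs_sum_le_sum_abs _ _).trans
          (Finset.sum_le_sum fun k _ => abs_mulVec_apply_le _ (hmag k) i)
    _ = α * ∑ k ∈ Finset.range (t + 1), ∑ j, |Φ (n - k) i j| := (Finset.mul_sum _ _ _).symm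
    _ ≤ α * ∑' k : ℕ, ∑ j, |Φ (k + s + 1) i j| :=
        mul_le_mul_of_nonneg_left
          (sum_range_sub_le_tsum (f := fun k => ∑ j, |Φ k i j|)
            (fun k => Finset.sum_nonneg fun j _ => abs_nonneg _) hn (hsum i)) hα
    _ ≤ _ := mul_le_mul_of_nonneg_left
        (le_ciSup (f := fun i : Fin p => ∑' k : ℕ, ∑ j, |Φ (k + s + 1) i j|)
          (Set.finite_range _).bddAbove i) hα

theorem ciSup_eq_sup'_range {f : ℕ → ℝ} {N : ℕ} (hN : (Finset.range N).Nonempty)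
    (hf : ∀ n, N ≤ n → f n ≤ (Finset.range N).sup' hN f) :
    ⨆ n, f n = (Finset.range N).sup' hN f := by
  have hle : ∀ n, f n ≤ (Finset.range N).sup' hN f := fun n =>
    (lt_or_ge n N).elim (fun h => Finset.le_sup' f (Finset.mem_range.2 h)) (hf n)
  refine le_antisymm (ciSup_le hle) (Finset.sup'_le _ _ fun n _ => ?_)
  exact le_ciSup ⟨_, Set.forall_mem_range.2 hle⟩ n


/-- Tail impact bound (Remark 1 of Section III): for an attack of magnitude at most
`α` supported on `{0,…,t_a}`, the impact at any time `n > t_a + t_zd` is bounded by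
`α` times the ℓ1 tail of the pulse response beyond `t_zd`; hence if this tail bound
does not exceed the maximal impact over the window `{0,…,t_a + t_zd}`, the window
captures the worst-case ℓ∞ impact. -/
theorem tail_impact_bound {p m : ℕ}
    (Φzd : ℕ → Matrix (Fin p) (Fin m) ℝ)
    (α : ℝ) (hα : 0 ≤ α) (t_a t_zd : ℕ)
    (hsum : ∀ i : Fin p, Summable fun k : ℕ => ∑ j, |Φzd (k + t_zd + 1) i j|)
    (d : ℕ → Fin m → ℝ)
    (hmag : ∀ k, ‖d k‖ ≤ α)
    (hsupp : ∀ k, t_a < k → d k = 0) :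
    (∀ n, t_a + t_zd < n →
      ‖conv Φzd d n‖ ≤
        α * ⨆ i : Fin p, ∑' k : ℕ, ∑ j, |Φzd (k + t_zd + 1) i j|) ∧
    ((α * ⨆ i : Fin p, ∑' k : ℕ, ∑ j, |Φzd (k + t_zd + 1) i j|) ≤
        (Finset.range (t_a + t_zd + 1)).sup' (by simp)
          (fun n => ‖conv Φzd d n‖) →
      (⨆ n : ℕ, ‖conv Φzd d n‖) =
        (Finset.range (t_a + t_zd + 1)).sup' (by simp)
          (fun n => ‖conv Φzd d n‖)) := by
  have htail := fun n (hn : t_a + t_zd < n) => norm_conv_le_tail Φzd hα hsum hmag hsupp hn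
  exact ⟨htail, fun h => ciSup_eq_sup'_range _ fun n hn => (htail n hn).trans h⟩
end

section
/- (Algorithm 1 correctness.) Let Φzd : ℕ → Matrix (Fin p) (Fin m) ℝ and Φψd : ℕ → Matrix (Fin q) (Fin m) ℝ be kernels, θ ≥ 0, α ≥ 0, t_a, t_zd, t_ψd ∈ ℕ, and let S be the set of signals d with |d(k)| ≤ α for all k ≤ t_a, d(k) = 0 for all k > t_a, and |(Φψd * d)(τ)| ≤ θ for all τ ≤ t_a + t_ψd. For each index n ∈ {0, …, t_a + t_zd} and component j ∈ Fin p, suppose d_{n,j} ∈ S attains the supremum over d ∈ S of ((Φzd * d)(n))_j. Then the maximum over all such (n, j) of max_{0 ≤ n' ≤ t_a + t_zd} |(Φzd * d_{n,j})(n')| equals the supremum over d ∈ S of max_{0 ≤ n ≤ t_a + t_zd} |(Φzd * d)(n)|; i.e., comparing the impacts of the finitely many per-row LP maximizers identifies the worst attack. -/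
theorem conv_neg {p m : ℕ} (Φ : ℕ → Matrix (Fin p) (Fin m) ℝ)
    (d : ℕ → Fin m → ℝ) (n : ℕ) : conv Φ (-d) n = -conv Φ d n := by
  simp [conv, Matrix.mulVec_neg]

/-- Algorithm 1 correctness: if for every row `n ∈ {0,…,t_a+t_zd}` and component
`j`, the signal `D n j` is a feasible maximizer of the signed linear objective
`((Φzd * d)(n))_j` over the feasible set `S`, then comparing the ℓ∞ impacts of
these finitely many per-row LP maximizers identifies the worst attack: their best
impact equals the supremum of the impact over all of `S`. -/
theorem algorithm1_correct {p q m : ℕ}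
    (Φzd : ℕ → Matrix (Fin p) (Fin m) ℝ)
    (Φψd : ℕ → Matrix (Fin q) (Fin m) ℝ)
    (θ α : ℝ) (hθ : 0 ≤ θ) (hα : 0 ≤ α) (t_a t_zd t_ψd : ℕ)
    (S : Set (ℕ → Fin m → ℝ))
    (hS : S = {d | (∀ k, k ≤ t_a → ‖d k‖ ≤ α) ∧ (∀ k, t_a < k → d k = 0) ∧
        (∀ τ, τ ≤ t_a + t_ψd → ‖conv Φψd d τ‖ ≤ θ)})
    (D : ℕ → Fin p → (ℕ → Fin m → ℝ))
    (hD_mem : ∀ n ∈ Finset.range (t_a + t_zd + 1), ∀ j : Fin p, D n j ∈ S)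
    (hD_max : ∀ n ∈ Finset.range (t_a + t_zd + 1), ∀ j : Fin p,
        ∀ d ∈ S, conv Φzd d n j ≤ conv Φzd (D n j) n j) :
    (Finset.range (t_a + t_zd + 1)).sup' (by simp)
        (fun n => ⨆ j : Fin p,
          (Finset.range (t_a + t_zd + 1)).sup' (by simp)
            (fun n' => ‖conv Φzd (D n j) n'‖)) =
    sSup {x : ℝ | ∃ d ∈ S,
        x = (Finset.range (t_a + t_zd + 1)).sup' (by simp)
              (fun n => ‖conv Φzd d n‖)} := by
  have neg_mem : ∀ d ∈ S, -d ∈ S := by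
    subst hS
    rintro d ⟨h_bound, h_supp, h_det⟩
    refine ⟨fun k hk => ?_, fun k hk => ?_, fun τ hτ => ?_⟩
    · simpa using h_bound k hk
    · simp [h_supp k hk]
    · simpa [conv_neg] using h_det τ hτ
  set R := Finset.range (t_a + t_zd + 1) with hR
  have hne : R.Nonempty := by simp [hR]
  have impact_nonneg : ∀ d, 0 ≤ R.sup' hne (fun n => ‖conv Φzd d n‖) := fun d =>
    (norm_nonneg _).trans (Finset.le_sup' (fun n => ‖conv Φzd d n‖) hne.choose_spec)
  set L := R.sup' hne (fun n => ⨆ j : Fin p, R.sup' hne (fun n' => ‖conv Φzd (D n j) n'‖))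
    with hL
  have row_le : ∀ n ∈ R, (⨆ j : Fin p, R.sup' hne (fun n' => ‖conv Φzd (D n j) n'‖)) ≤ L :=
    fun n hn => Finset.le_sup'
      (fun n => ⨆ j : Fin p, R.sup' hne (fun n' => ‖conv Φzd (D n j) n'‖)) hn
  have hL_nonneg : 0 ≤ L :=
    (Real.iSup_nonneg fun j => impact_nonneg _).trans (row_le _ hne.choose_spec)
  have entry_le : ∀ d ∈ S, ∀ n ∈ R, ∀ j, conv Φzd d n j ≤ L := fun d hd n hn j =>
    calc conv Φzd d n j ≤ conv Φzd (D n j) n j := hD_max n hn j d hd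
      _ ≤ ‖conv Φzd (D n j) n‖ := (Real.le_norm_self _).trans (norm_le_pi_norm _ j)
      _ ≤ R.sup' hne (fun n' => ‖conv Φzd (D n j) n'‖) :=
        Finset.le_sup' (fun n' => ‖conv Φzd (D n j) n'‖) hn
      _ ≤ ⨆ j : Fin p, R.sup' hne (fun n' => ‖conv Φzd (D n j) n'‖) :=
        le_ciSup (f := fun j : Fin p => R.sup' hne (fun n' => ‖conv Φzd (D n j) n'‖))
          (Set.finite_range _).bddAbove j
      _ ≤ L := row_le n hn
  have impact_le : ∀ d ∈ S, R.sup' hne (fun n => ‖conv Φzd d n‖) ≤ L := by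
    refine fun d hd => Finset.sup'_le _ _ fun n hn => ?_
    refine (pi_norm_le_iff_of_nonneg hL_nonneg).2 fun j => ?_
    have h := entry_le (-d) (neg_mem d hd) n hn j
    rw [conv_neg, Pi.neg_apply] at h
    exact abs_le'.2 ⟨entry_le d hd n hn j, h⟩
  apply le_antisymm
  · refine Finset.sup'_le _ _ fun n hn => Real.iSup_le (fun j => ?_) ?_
    · refine le_csSup ⟨L, ?_⟩ ⟨D n j, hD_mem n hn j, rfl⟩
      rintro x ⟨d, hd, rfl⟩
      exact impact_le d hd
    · refine Real.sSup_nonneg ?_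
      rintro x ⟨d, -, rfl⟩
      exact impact_nonneg d
  · refine Real.sSup_le ?_ hL_nonneg
    rintro x ⟨d, hd, rfl⟩
    exact impact_le d hd
end
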